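/- With A_θ := A_u A_th and κ₁ := κ₀ − A_th θ̂, for every θ ∈ ℝ^ℓ with ‖θ‖ ≤ θ₀ the following inequality holds: wᵀ(a_x + A_u κ₁ + A_θ θ) − (θ−θ̂)ᵀ Proj(A_θᵀ w, θ̂) ≤ wᵀ(a_x + A_u κ₀). (This is the adaptive Lyapunov decrease property: the derivative bound of V₁ along the adaptive closed loop does not exceed that of V₀ along the nominal closed loop.) -/

import Mathlib

open Matrix

/-- `p(θ̂) := (‖θ̂‖² − θ₀²)/(ε² + 2εθ₀)`, with `‖θ̂‖² = θ̂ ⬝ᵥ θ̂` the squared Euclidean norm. -/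
noncomputable def pFun {l : ℕ} (θ₀ ε : ℝ) (θh : Fin l → ℝ) : ℝ :=
  (θh ⬝ᵥ θh - θ₀ ^ 2) / (ε ^ 2 + 2 * ε * θ₀)

/-- The projection operator
`Proj(η,θ̂) := η` if `p(θ̂) ≤ 0` or `θ̂ᵀη ≤ 0`, and
`Proj(η,θ̂) := η − p(θ̂)·(θ̂ᵀη/‖θ̂‖²)·θ̂` otherwise. -/
noncomputable def Proj {l : ℕ} (θ₀ ε : ℝ) (η θh : Fin l → ℝ) : Fin l → ℝ :=
  if pFun θ₀ ε θh ≤ 0 ∨ θh ⬝ᵥ η ≤ 0 then η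
  else η - (pFun θ₀ ε θh * (θh ⬝ᵥ η / (θh ⬝ᵥ θh))) • θh

/-- With `A_θ := A_u A_th` and `κ₁ := κ₀ − A_th θ̂`, for every `θ` with
Euclidean norm `‖θ‖ = √(θᵀθ) ≤ θ₀`:
`wᵀ(a_x + A_u κ₁ + A_θ θ) − (θ−θ̂)ᵀ Proj(A_θᵀ w, θ̂) ≤ wᵀ(a_x + A_u κ₀)`. -/
theorem stmt14 {n m l : ℕ}
    (a_x : Fin n → ℝ) (A_u : Matrix (Fin n) (Fin m) ℝ) (A_th : Matrix (Fin m) (Fin l) ℝ)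
    (κ₀ : Fin m → ℝ) (w : Fin n → ℝ) (θh : Fin l → ℝ)
    (θ₀ ε : ℝ) (hθ₀ : 0 < θ₀) (hε : 0 < ε) :
    ∀ θ : Fin l → ℝ, Real.sqrt (θ ⬝ᵥ θ) ≤ θ₀ →
      w ⬝ᵥ (a_x + A_u.mulVec (κ₀ - A_th.mulVec θh) + (A_u * A_th).mulVec θ) -
          (θ - θh) ⬝ᵥ Proj θ₀ ε ((A_u * A_th)ᵀ.mulVec w) θh
        ≤ w ⬝ᵥ (a_x + A_u.mulVec κ₀) := by
  intro θ hθ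
  have h1 : θ ⬝ᵥ θ ≤ θ₀ ^ 2 := (Real.sqrt_le_left hθ₀.le).mp hθ
  have hη : ∀ v : Fin l → ℝ,
      v ⬝ᵥ ((A_u * A_th)ᵀ.mulVec w) = w ⬝ᵥ (A_u * A_th).mulVec v := by
    intro v
    rw [Matrix.mulVec_transpose, dotProduct_comm, ← Matrix.dotProduct_mulVec]
  have hexp : w ⬝ᵥ (a_x + A_u.mulVec (κ₀ - A_th.mulVec θh) + (A_u * A_th).mulVec θ)
      = w ⬝ᵥ (a_x + A_u.mulVec κ₀) + (θ - θh) ⬝ᵥ ((A_u * A_th)ᵀ.mulVec w) := by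
    rw [hη]
    simp only [Matrix.mulVec_sub, Matrix.mulVec_mulVec, dotProduct_add, dotProduct_sub]
    ring
  rw [hexp]
  generalize (A_u * A_th)ᵀ.mulVec w = η
  unfold Proj
  split_ifs with h
  · linarith
  · push Not at h
    obtain ⟨hp, hd⟩ := h
    have hnum : 0 < θh ⬝ᵥ θh - θ₀ ^ 2 := by
      unfold pFun at hp
      exact (div_pos_iff_of_pos_right (by positivity)).mp hp
    have hpos : 0 < θh ⬝ᵥ θh := by nlinarith
    have hc : 0 < pFun θ₀ ε θh * (θh ⬝ᵥ η / (θh ⬝ᵥ θh)) := mul_pos hp (div_pos hd hpos)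
    have hsq : 0 ≤ (θ - θh) ⬝ᵥ (θ - θh) := by
      unfold dotProduct
      exact Finset.sum_nonneg fun i _ => mul_self_nonneg _
    have hle : (θ - θh) ⬝ᵥ θh ≤ 0 := by
      simp only [dotProduct_sub, sub_dotProduct] at hsq ⊢
      rw [dotProduct_comm θh θ] at hsq
      linarith
    rw [dotProduct_sub, dotProduct_smul, smul_eq_mul]
    nlinarith [mul_nonneg hc.le (neg_nonneg.mpr hle)]
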